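/- (Intermediate step in the proof of Lemma 1.) For every σ ∈ H = ℤ^{4g+2} there exists an element φ of the subgroup of GL(H) generated by the maps R_{z_i}, R_{x_i}, R_{z_i+z_j}, R_{z_i+x_j} (for all 1 ≤ i, j ≤ g with i ≠ j) such that a_i(φ(σ))·b_i(φ(σ)) + c_i(φ(σ))·d_i(φ(σ)) = 0 for every i with 2 ≤ i ≤ g. -/

import Mathlib

/-!
Model for `H₂(Σ_g × T²) ≅ ℤ^(4g+2)`: index set `(Fin g × Fin 4) ⊕ Fin 2`,
where for a block `i`, the four coordinates `(i,0), (i,1), (i,2), (i,3)` are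
`a_i, b_i, c_i, d_i`, and `Sum.inr 0`, `Sum.inr 1` are `e`, `f`.
Blocks are indexed `0, …, g-1` (corresponding to `1, …, g` in the paper).
-/

namespace MinGenusT2

abbrev Idx (g : ℕ) := (Fin g × Fin 4) ⊕ Fin 2

/-- `H = ℤ^{4g+2}`. -/
abbrev Hmod (g : ℕ) := Idx g → ℤ

variable {g : ℕ}

def aIx (i : Fin g) : Idx g := Sum.inl (i, 0)
def bIx (i : Fin g) : Idx g := Sum.inl (i, 1)
def cIx (i : Fin g) : Idx g := Sum.inl (i, 2)
def dIx (i : Fin g) : Idx g := Sum.inl (i, 3)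
def eIx : Idx g := Sum.inr 0
def fIx : Idx g := Sum.inr 1

/-- The intersection form `Q`, an orthogonal sum of `2g+1` hyperbolic planes. -/
def Q (σ τ : Hmod g) : ℤ :=
  (∑ i : Fin g, (σ (aIx i) * τ (bIx i) + τ (aIx i) * σ (bIx i)
      + σ (cIx i) * τ (dIx i) + τ (cIx i) * σ (dIx i)))
    + σ eIx * τ fIx + τ eIx * σ fIx

/-- `R_{z_i}` : `b_i ↦ b_i − c_i`, `d_i ↦ d_i + a_i`. -/
def Rz (i : Fin g) : Hmod g → Hmod g := fun σ k =>
  if k = bIx i then σ (bIx i) - σ (cIx i)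
  else if k = dIx i then σ (dIx i) + σ (aIx i)
  else σ k

/-- `R_{x_i}` : `a_i ↦ a_i − d_i`, `c_i ↦ c_i + b_i`. -/
def Rx (i : Fin g) : Hmod g → Hmod g := fun σ k =>
  if k = aIx i then σ (aIx i) - σ (dIx i)
  else if k = cIx i then σ (cIx i) + σ (bIx i)
  else σ k

/-- `R_{z_i+z_j}` (`i ≠ j`). -/
def Rzz (i j : Fin g) : Hmod g → Hmod g := fun σ k =>
  if k = bIx i then σ (bIx i) - σ (cIx i) - σ (cIx j)
  else if k = dIx i then σ (dIx i) + σ (aIx i) + σ (aIx j)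
  else if k = bIx j then σ (bIx j) - σ (cIx i) - σ (cIx j)
  else if k = dIx j then σ (dIx j) + σ (aIx i) + σ (aIx j)
  else σ k

/-- `R_{z_i+x_j}` (`i ≠ j`). -/
def Rzx (i j : Fin g) : Hmod g → Hmod g := fun σ k =>
  if k = bIx i then σ (bIx i) - σ (cIx i) + σ (bIx j)
  else if k = dIx i then σ (dIx i) + σ (aIx i) + σ (dIx j)
  else if k = aIx j then σ (aIx j) - σ (aIx i) - σ (dIx j)
  else if k = cIx j then σ (cIx j) - σ (cIx i) + σ (bIx j)
  else σ k


/-- The set of Dehn-twist-induced automorphisms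
`R_{z_i}, R_{x_i}, R_{z_i+z_j}, R_{z_i+x_j}` (`i ≠ j`), as elements of `GL(H)`
(the group of ℤ-linear automorphisms of `H`). -/
def dehnGens (g : ℕ) : Set (Hmod g ≃ₗ[ℤ] Hmod g) :=
  {φ | (∃ i, ⇑φ = Rz i) ∨ (∃ i, ⇑φ = Rx i) ∨
    (∃ i j, i ≠ j ∧ ⇑φ = Rzz i j) ∨ (∃ i j, i ≠ j ∧ ⇑φ = Rzx i j)}

/-- If a generator has the form `f = 1 + N` with `N ^ 2 = 0`, then `1 + ε * N` with `ε = ±1` lies in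
the subgroup generated by the `R`-maps. -/
lemma exists_mem_closure_of_unipotent {g : ℕ} (f : Hmod g → Hmod g) (hf : IsLinearMap ℤ f)
    (hsq : ∀ σ k, f (f σ) k = 2 * f σ k - σ k)
    (hgen : ∀ φ : Hmod g ≃ₗ[ℤ] Hmod g, ⇑φ = f → φ ∈ dehnGens g)
    (ε : ℤ) (hε : ε = 1 ∨ ε = -1) :
    ∃ φ ∈ Subgroup.closure (dehnGens g), ∀ σ k, φ σ k = σ k + ε * (f σ k - σ k) := by
  have hinv : ∀ σ, f ((2 : ℤ) • σ - f σ) = σ := by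
    intro σ
    rw [hf.map_sub, hf.map_smul]
    funext k
    simp only [Pi.sub_apply, Pi.smul_apply, smul_eq_mul, hsq]
    ring
  let φ : Hmod g ≃ₗ[ℤ] Hmod g :=
    { hf.mk' f with
      invFun := fun σ => (2 : ℤ) • σ - f σ
      left_inv := fun σ => by
        funext k
        change 2 * f σ k - f (f σ) k = σ k
        rw [hsq]
        ring
      right_inv := hinv }
  have hφ : φ ∈ Subgroup.closure (dehnGens g) := Subgroup.subset_closure (hgen φ rfl)
  rcases hε with rfl | rfl
  · exact ⟨φ, hφ, fun σ k => by change f σ k = _; ring⟩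
  · refine ⟨φ⁻¹, inv_mem hφ, fun σ k => ?_⟩
    change 2 * σ k - f σ k = _
    ring

/-- The coordinates `a` and `d` of some element of the orbit of `σ`. -/
def Reach {g : ℕ} (σ : Hmod g) (a d : Fin g → ℤ) : Prop :=
  ∃ φ ∈ Subgroup.closure (dehnGens g), (∀ k, φ σ (aIx k) = a k) ∧ ∀ k, φ σ (dIx k) = d k

lemma Reach.step {g : ℕ} {σ : Hmod g} {a d a' d' : Fin g → ℤ} (h : Reach σ a d)
    (h' : ∃ φ ∈ Subgroup.closure (dehnGens g), ∀ τ : Hmod g, (∀ k, τ (aIx k) = a k) →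
      (∀ k, τ (dIx k) = d k) → (∀ k, φ τ (aIx k) = a' k) ∧ ∀ k, φ τ (dIx k) = d' k) :
    Reach σ a' d' := by
  obtain ⟨φ, hφ, ha, hd⟩ := h
  obtain ⟨ψ, hψ, hs⟩ := h'
  exact ⟨ψ * φ, mul_mem hψ hφ, hs (φ σ) ha hd⟩

lemma Reach.z {g : ℕ} {σ : Hmod g} {a d : Fin g → ℤ} (h : Reach σ a d) (i : Fin g)
    {ε : ℤ} (hε : ε = 1 ∨ ε = -1) :
    Reach σ a (Function.update d i (d i + ε * a i)) := by
  obtain ⟨φ, hφ, hs⟩ := exists_mem_closure_of_unipotent (Rz i)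
    ⟨fun x y => by funext k; simp only [Rz, Pi.add_apply]; split_ifs <;> ring,
      fun c x => by funext k; simp only [Rz, Pi.smul_apply, smul_eq_mul]; split_ifs <;> ring⟩
    (fun τ k => by
      simp only [Rz]
      split_ifs <;> simp_all [aIx, bIx, cIx, dIx] <;> ring)
    (fun φ h => Or.inl ⟨i, h⟩) ε hε
  refine h.step ⟨φ, hφ, fun τ ha hd => ⟨fun k => ?_, fun k => ?_⟩⟩
  · simp [hs, Rz, aIx, bIx, dIx, ← ha]
  · by_cases hk : k = i
    · subst hk
      simp [hs, Rz, ← ha, ← hd]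
      simp [dIx, bIx]
    · simp [hs, Rz, dIx, bIx, hk, ← hd]

lemma Reach.x {g : ℕ} {σ : Hmod g} {a d : Fin g → ℤ} (h : Reach σ a d) (i : Fin g)
    {ε : ℤ} (hε : ε = 1 ∨ ε = -1) :
    Reach σ (Function.update a i (a i + ε * d i)) d := by
  obtain ⟨φ, hφ, hs⟩ := exists_mem_closure_of_unipotent (Rx i)
    ⟨fun x y => by funext k; simp only [Rx, Pi.add_apply]; split_ifs <;> ring,
      fun c x => by funext k; simp only [Rx, Pi.smul_apply, smul_eq_mul]; split_ifs <;> ring⟩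
    (fun τ k => by
      simp only [Rx]
      split_ifs <;> simp_all [aIx, bIx, cIx, dIx] <;> ring)
    (fun φ h => Or.inr (Or.inl ⟨i, h⟩)) (-ε) (by omega)
  refine h.step ⟨φ, hφ, fun τ ha hd => ⟨fun k => ?_, fun k => ?_⟩⟩
  · by_cases hk : k = i
    · subst hk
      simp [hs, Rx, ← ha, ← hd]
    · simp [hs, Rx, aIx, cIx, hk, ← ha]
  · simp [hs, Rx, aIx, cIx, dIx, ← hd]

lemma Reach.zx {g : ℕ} {σ : Hmod g} {a d : Fin g → ℤ} (h : Reach σ a d) {i j : Fin g}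
    (hij : i ≠ j) {ε : ℤ} (hε : ε = 1 ∨ ε = -1) :
    Reach σ (Function.update a j (a j + ε * (a i + d j)))
      (Function.update d i (d i - ε * (a i + d j))) := by
  obtain ⟨φ, hφ, hs⟩ := exists_mem_closure_of_unipotent (Rzx i j)
    ⟨fun x y => by funext k; simp only [Rzx, Pi.add_apply]; split_ifs <;> ring,
      fun c x => by funext k; simp only [Rzx, Pi.smul_apply, smul_eq_mul]; split_ifs <;> ring⟩
    (fun τ k => by
      simp only [Rzx, aIx, bIx, cIx, dIx, Sum.inl.injEq, Prod.mk.injEq, hij, hij.symm,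
        Fin.reduceEq, and_true, and_false, if_true, if_false]
      grind)
    (fun φ h => Or.inr (Or.inr (Or.inr ⟨i, j, hij, h⟩))) (-ε) (by omega)
  refine h.step ⟨φ, hφ, fun τ ha hd => ⟨fun k => ?_, fun k => ?_⟩⟩
  · rw [hs]
    by_cases hk : k = j
    · subst hk
      rw [Function.update_self, ← ha, ← ha, ← hd]
      simp [Rzx, aIx, bIx, dIx]
      ring
    · simp [Rzx, aIx, bIx, cIx, dIx, hk, ← ha]
  · rw [hs]
    by_cases hk : k = i
    · subst hk
      rw [Function.update_self, ← ha, ← hd, ← hd]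
      simp [Rzx, aIx, bIx, dIx]
      ring
    · simp [Rzx, aIx, bIx, cIx, dIx, hk, ← hd]

lemma Reach.add_of_d_eq_zero {g : ℕ} {σ : Hmod g} {a : Fin g → ℤ} (h : Reach σ a 0)
    {i j : Fin g} (hij : i ≠ j) {ε : ℤ} (hε : ε = 1 ∨ ε = -1) :
    Reach σ (Function.update a j (a j + ε * a i)) 0 := by
  have := (h.zx hij hε).z i hε
  simpa [hij] using this

/-- A weighted `ℓ¹`-size of the coordinates `a`, `d`. -/
def size {g : ℕ} (w a d : Fin g → ℤ) : ℤ := ∑ k, w k * (|a k| + 2 * |d k|)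

lemma size_update_left {g : ℕ} (w a d : Fin g → ℤ) (i : Fin g) (x : ℤ) :
    size w (Function.update a i x) d = size w a d + w i * (|x| - |a i|) := by
  rw [← sub_eq_iff_eq_add', size, size, ← Finset.sum_sub_distrib, Finset.sum_eq_single i]
  · simp; ring
  · intro k _ hk; simp [hk]
  · simp

lemma size_update_right {g : ℕ} (w a d : Fin g → ℤ) (i : Fin g) (x : ℤ) :
    size w a (Function.update d i x) = size w a d + 2 * w i * (|x| - |d i|) := by
  rw [← sub_eq_iff_eq_add', size, size, ← Finset.sum_sub_distrib, Finset.sum_eq_single i]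
  · simp; ring
  · intro k _ hk; simp [hk]
  · simp

lemma exists_abs_add_sign_mul_lt {x y : ℤ} (hx : x ≠ 0) (hxy : |x| ≤ |y|) :
    ∃ ε : ℤ, (ε = 1 ∨ ε = -1) ∧ |y + ε * x| < |y| := by
  by_cases h : |y + x| < |y|
  · exact ⟨1, Or.inl rfl, by simpa using h⟩
  · refine ⟨-1, Or.inr rfl, ?_⟩
    rw [neg_one_mul]
    grind

lemma exists_reach_minimal {g : ℕ} (σ : Hmod g) (w : Fin g → ℤ) (hw : ∀ k, 0 < w k) :
    ∃ a d, Reach σ a d ∧ ∀ a' d', Reach σ a' d' → size w a d ≤ size w a' d' := by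
  have hne : {p : (Fin g → ℤ) × (Fin g → ℤ) | Reach σ p.1 p.2}.Nonempty :=
    ⟨(fun k => σ (aIx k), fun k => σ (dIx k)), 1, one_mem _, fun _ => rfl, fun _ => rfl⟩
  have hnonneg : ∀ a d, 0 ≤ size w a d := fun a d =>
    Finset.sum_nonneg fun k _ => mul_nonneg (hw k).le (by positivity)
  obtain ⟨p, hp, hmin⟩ := exists_minimalFor_of_wellFoundedLT
    (fun p : (Fin g → ℤ) × (Fin g → ℤ) => Reach σ p.1 p.2)
    (fun p => (size w p.1 p.2).toNat) hne
  refine ⟨p.1, p.2, hp, fun a' d' h' => ?_⟩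
  have := hmin (j := (a', d')) h'
  have h1 := hnonneg p.1 p.2
  have h2 := hnonneg a' d'
  simp only at this
  omega

lemma exists_reach_concentrated {g : ℕ} (σ : Hmod g) (o : Fin g) :
    ∃ a, Reach σ a 0 ∧ ∀ j, j ≠ o → a j = 0 := by
  let w : Fin g → ℤ := fun k => if k = o then 1 else 2
  have hw : ∀ k, 0 < w k := fun k => by simp only [w]; split_ifs <;> norm_num
  obtain ⟨a, d, h, hmin⟩ := exists_reach_minimal σ w hw
  have hd : d = 0 := by
    funext i
    by_contra hdi
    change d i ≠ 0 at hdi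
    have hwi := hw i
    by_cases hai : a i = 0
    · have h' := (h.x i (Or.inl rfl)).z i (Or.inr rfl)
      have := hmin _ _ h'
      rw [size_update_right, size_update_left] at this
      simp only [hai, Function.update_self] at this
      simp only [zero_add, one_mul, neg_mul, add_neg_cancel, abs_zero] at this
      nlinarith [abs_pos.2 hdi]
    · rcases le_total |a i| |d i| with hle | hle
      · obtain ⟨ε, hε, hlt⟩ := exists_abs_add_sign_mul_lt hai hle
        have := hmin _ _ (h.z i hε)
        rw [size_update_right] at this
        nlinarith
      · obtain ⟨ε, hε, hlt⟩ := exists_abs_add_sign_mul_lt hdi hle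
        have := hmin _ _ (h.x i hε)
        rw [size_update_left] at this
        nlinarith
  subst hd
  refine ⟨a, h, fun j hj => ?_⟩
  by_contra haj
  by_cases hao : a o = 0
  · have h' := (h.add_of_d_eq_zero hj (Or.inl rfl)).add_of_d_eq_zero hj.symm (Or.inr rfl)
    have := hmin _ _ h'
    rw [size_update_left, size_update_left] at this
    simp [hao, hj, w] at this
    linarith [abs_pos.2 haj]
  · rcases le_total |a j| |a o| with hle | hle
    · obtain ⟨ε, hε, hlt⟩ := exists_abs_add_sign_mul_lt haj hle
      have := hmin _ _ (h.add_of_d_eq_zero hj hε)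
      rw [size_update_left] at this
      nlinarith [hw o]
    · obtain ⟨ε, hε, hlt⟩ := exists_abs_add_sign_mul_lt hao hle
      have := hmin _ _ (h.add_of_d_eq_zero hj.symm hε)
      rw [size_update_left] at this
      nlinarith [hw j]

/-- intermediate step in the proof of Lemma 1: every `σ ∈ H` can be
moved by an element of the subgroup of `GL(H)` generated by the `R`-maps to a class
with `a_i·b_i + c_i·d_i = 0` for all `i ≥ 2` (blocks are indexed `0, …, g-1` here,
so this reads `i ≥ 1`). -/
theorem statement2 (g : ℕ) (hg : 1 ≤ g) (σ : Hmod g) :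
    ∃ φ ∈ Subgroup.closure (dehnGens g), ∀ i : Fin g, 1 ≤ (i : ℕ) →
      φ σ (aIx i) * φ σ (bIx i) + φ σ (cIx i) * φ σ (dIx i) = 0 := by
  obtain ⟨a, ⟨φ, hφ, ha, hd⟩, hzero⟩ := exists_reach_concentrated σ ⟨0, hg⟩
  refine ⟨φ, hφ, fun i hi => ?_⟩
  have hi0 : i ≠ ⟨0, hg⟩ := by
    rintro rfl
    simp at hi
  simp [ha, hd, hzero i hi0]

end MinGenusT2
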